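/- arXiv:2503.06811 — 2 statements merged into one kernel-verified Lean document; each statement's English description precedes it below -/
import Mathlib

section
/- Let a ≥ 0, b ∈ ℝ, T > 0, k > 0, h ∈ L²(ℝ) with h ≥ 0, and let G : ℝ → ℝ be four times continuously differentiable, with G and all its derivatives up to order 4 in L¹(ℝ), and with G and its derivatives up to order 3 tending to 0 as |x| → ∞. Let v : ℝ × [0,T] → ℝ be measurable with v(·,t) ∈ L²(ℝ) for a.e. t and ∫₀ᵀ ‖v(·,t)‖²_{L²(ℝ)} dt < ∞, and let w : ℝ × [0,T] → ℝ be measurable with w(·,s) ∈ L¹(ℝ) ∩ L²(ℝ) and ‖w(·,s)‖_{L²(ℝ)} ≤ k‖v(·,s)‖_{L²(ℝ)} + ‖h‖_{L²(ℝ)} for a.e. s ∈ [0,T]. Then ∫₀ᵀ ∫_ℝ p⁸ | ∫₀ᵗ e^{(t−s)(−p⁴+ibp+a)} √(2π) Ĝ(p) ŵ(p,s) ds |² dp dt ≤ e^{2aT} ‖d⁴G/dx⁴‖²_{L¹(ℝ)} T² ( k‖v‖_{L²(ℝ×[0,T])} + √T ‖h‖_{L²(ℝ)} )². -/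
open MeasureTheory

/-- The Fourier transform `φ̂(p) = (2π)^{-1/2} ∫ φ(x) e^{-ipx} dx`. -/
noncomputable def FT (φ : ℝ → ℝ) (p : ℝ) : ℂ :=
  (Real.sqrt (2 * Real.pi))⁻¹ *
    ∫ x : ℝ, (φ x : ℂ) * Complex.exp (-(Complex.I * p * x))

lemma aux_eL2 {E : Type*} [NormedAddCommGroup E] (μ : Measure ℝ) (f : ℝ → E) :
    eLpNorm f 2 μ ^ 2 = ∫⁻ x, ‖f x‖ₑ ^ 2 ∂μ := by
  have := eLpNorm_nnreal_pow_eq_lintegral (f := f) (μ := μ) (p := 2) (by norm_num)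
  simpa using! this

open FourierTransform SchwartzMap in
lemma aux_fourier_ae (f : ℝ → ℂ) (h1 : Integrable f) (h2 : MemLp f 2) :
    𝓕 f =ᵐ[volume] (𝓕 (h2.toLp f) : Lp (α := ℝ) ℂ 2) := by
  have hcont : Continuous (𝓕 f) :=
    VectorFourier.fourierIntegral_continuous Real.continuous_fourierChar
      (L := innerₗ ℝ) continuous_inner h1
  refine ae_eq_of_integral_contDiff_smul_eq hcont.locallyIntegrable ?_ ?_
  · exact (Lp.memLp _).locallyIntegrable (by norm_num)
  intro g hg hgc
  have hg' : ContDiff ℝ (↑(⊤ : ℕ∞)) (fun x => (g x : ℂ)) :=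
    Complex.ofRealCLM.contDiff.comp hg
  have hgc' : HasCompactSupport (fun x => (g x : ℂ)) := hgc.comp_left (g := Complex.ofReal) (by simp)
  set φ : 𝓢(ℝ, ℂ) := hgc'.toSchwartzMap hg' with hφ
  have e := congrArg (fun D => D φ) (Lp.fourier_toTemperedDistribution_eq (h2.toLp f))
  simp only [TemperedDistribution.fourier_apply, Lp.toTemperedDistribution_apply] at e
  have e2 : ∫ ξ, (𝓕 φ ξ) • f ξ = ∫ x, φ x • 𝓕 f x := by
    simpa using! VectorFourier.integral_fourierIntegral_smul_eq_flip (L := innerₗ ℝ)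
      Real.continuous_fourierChar continuous_inner φ.integrable h1
  have e3 : ∫ ξ, (𝓕 φ ξ) • f ξ = ∫ ξ, (𝓕 φ ξ) • (h2.toLp f) ξ := by
    apply integral_congr_ae
    filter_upwards [h2.coeFn_toLp] with x hx
    rw [hx]
  have e4 : ∀ x, φ x = (g x : ℂ) := fun x => rfl
  rw [← e3, e2] at e
  simpa [e4] using e

open FourierTransform in
lemma aux_plancherel (f : ℝ → ℂ) (h1 : Integrable f) (h2 : MemLp f 2) :
    ∫⁻ p, ‖𝓕 f p‖ₑ ^ 2 = ∫⁻ x, ‖f x‖ₑ ^ 2 := by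
  have key : eLpNorm (𝓕 f) 2 volume = eLpNorm f 2 volume := by
    rw [eLpNorm_congr_ae (aux_fourier_ae f h1 h2), ← Lp.enorm_def, ← Lp.enorm_toLp h2,
      ← ofReal_norm, ← ofReal_norm, Lp.norm_fourier_eq]
  have := congrArg (fun z => z ^ 2) key
  simpa only [aux_eL2] using this

open FourierTransform in
lemma aux_FT (φ : ℝ → ℝ) (p : ℝ) :
    FT φ p = ((Real.sqrt (2 * Real.pi))⁻¹ : ℝ) * 𝓕 (fun x => (φ x : ℂ)) ((2 * Real.pi)⁻¹ * p) := by
  rw [FT, Real.fourier_real_eq_integral_exp_smul]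
  congr 1
  refine integral_congr_ae (Filter.Eventually.of_forall fun x => ?_)
  simp only [smul_eq_mul]
  rw [mul_comm]
  congr 2
  have : (Real.pi : ℂ) ≠ 0 := by exact_mod_cast Real.pi_ne_zero
  push_cast
  field_simp

open FourierTransform in
lemma aux_FT_L2 (φ : ℝ → ℝ) (h1 : Integrable φ) (h2 : Integrable (fun x => φ x ^ 2)) :
    ∫⁻ p, ‖FT φ p‖ₑ ^ 2 = ENNReal.ofReal (∫ x, φ x ^ 2) := by
  have hm : MemLp φ 2 := (memLp_two_iff_integrable_sq h1.aestronglyMeasurable).2 h2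
  have hcont : Continuous (𝓕 (fun x => (φ x : ℂ))) :=
    VectorFourier.fourierIntegral_continuous Real.continuous_fourierChar
      (L := innerₗ ℝ) continuous_inner h1.ofReal
  have hpi : (0:ℝ) < 2 * Real.pi := by positivity
  have e1 : ∀ p, ‖FT φ p‖ₑ ^ 2 = ENNReal.ofReal (2 * Real.pi)⁻¹ *
      ‖𝓕 (fun x => (φ x : ℂ)) ((2 * Real.pi)⁻¹ * p)‖ₑ ^ 2 := by
    intro p
    rw [aux_FT, enorm_mul, mul_pow]
    congr 1
    rw [← ofReal_norm, ← ENNReal.ofReal_pow (norm_nonneg _), Complex.norm_real, Real.norm_eq_abs,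
      sq_abs, inv_pow, Real.sq_sqrt hpi.le]
  have hmeas : Measurable fun q => ‖𝓕 (fun x => (φ x : ℂ)) q‖ₑ ^ 2 := by
    exact (hcont.measurable.enorm).pow_const 2
  simp_rw [e1]
  rw [lintegral_const_mul _ (by exact hmeas.comp (measurable_const_mul _)),
    ← lintegral_map (f := fun q => ‖𝓕 (fun x => (φ x : ℂ)) q‖ₑ ^ 2) hmeas (measurable_const_mul _)]
  erw [Real.map_volume_mul_left (inv_ne_zero hpi.ne')]
  rw [lintegral_smul_measure, inv_inv, abs_of_pos hpi, smul_eq_mul, ← mul_assoc,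
    ← ENNReal.ofReal_mul (by positivity), inv_mul_cancel₀ hpi.ne', ENNReal.ofReal_one, one_mul]
  refine (aux_plancherel _ h1.ofReal hm.ofReal).trans ?_
  rw [ofReal_integral_eq_lintegral_ofReal h2 (Filter.Eventually.of_forall fun x => sq_nonneg _)]
  refine lintegral_congr fun x => ?_
  change ‖((φ x : ℝ) : ℂ)‖ₑ ^ 2 = _
  rw [← ofReal_norm, ← ENNReal.ofReal_pow (norm_nonneg _), Complex.norm_real, Real.norm_eq_abs,
      sq_abs]

open FourierTransform in
lemma aux_G (G : ℝ → ℝ) (hGsmooth : ContDiff ℝ 4 G)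
    (hGint : ∀ n : ℕ, n ≤ 4 → Integrable (iteratedDeriv n G)) (p : ℝ) :
    p ^ 4 * ‖(Real.sqrt (2 * Real.pi) : ℂ) * FT G p‖ ≤ ∫ x : ℝ, |iteratedDeriv 4 G x| := by
  have hpi : (0:ℝ) < 2 * Real.pi := by positivity
  have hpi' : (Real.pi : ℂ) ≠ 0 := by exact_mod_cast Real.pi_ne_zero
  have hs : Real.sqrt (2 * Real.pi) ≠ 0 := (Real.sqrt_pos.2 hpi).ne'
  have hd : ∀ n : ℕ, n ≤ 4 →
      iteratedDeriv n (fun x => (G x : ℂ)) = fun x => ((iteratedDeriv n G x : ℝ) : ℂ) := by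
    intro n
    induction n with
    | zero => intro _; simp
    | succ n ih =>
      intro hn
      rw [iteratedDeriv_succ, ih (by omega)]
      funext x
      have hdiff : DifferentiableAt ℝ (iteratedDeriv n G) x :=
        (hGsmooth.differentiable_iteratedDeriv n (by exact_mod_cast hn)) x
      rw [iteratedDeriv_succ]
      exact hdiff.hasDerivAt.ofReal_comp.deriv
  have hG' : ContDiff ℝ ((4 : ℕ∞) : WithTop ℕ∞) (fun x => (G x : ℂ)) :=
    Complex.ofRealCLM.contDiff.comp hGsmooth
  have key := congrFun (Real.fourier_iteratedDeriv (n := 4) hG' (fun n hn => by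
    have hn' : n ≤ 4 := by exact_mod_cast hn
    rw [hd n hn']; exact (hGint n hn').ofReal) le_rfl) ((2 * Real.pi)⁻¹ * p)
  have e : p ^ 4 * ‖(Real.sqrt (2 * Real.pi) : ℂ) * FT G p‖ =
      ‖𝓕 (iteratedDeriv 4 (fun x => (G x : ℂ))) ((2 * Real.pi)⁻¹ * p)‖ := by
    rw [key, aux_FT, norm_smul, ← mul_assoc, ← Complex.ofReal_mul, mul_inv_cancel₀ hs]
    simp only [Complex.ofReal_one, one_mul]
    congr 1
    have : (2 * (Real.pi:ℂ) * Complex.I * (((2 * Real.pi)⁻¹ * p : ℝ) : ℂ)) = Complex.I * p := by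
      push_cast; field_simp
    rw [this]
    simp [mul_pow, Even.pow_abs (show Even 4 by decide)]
  rw [e, hd 4 le_rfl]
  refine (VectorFourier.norm_fourierIntegral_le_integral_norm _ _ _ _ _).trans (le_of_eq ?_)
  simp

lemma aux_CS (μ : Measure ℝ) [IsFiniteMeasure μ] (f : ℝ → ℂ) (hf : AEStronglyMeasurable f μ) :
    (∫⁻ s, ‖f s‖ₑ ∂μ) ^ 2 ≤ μ Set.univ * ∫⁻ s, ‖f s‖ₑ ^ 2 ∂μ := by
  have := eLpNorm_le_eLpNorm_mul_rpow_measure_univ (p := 1) (q := 2) (by norm_num) hf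
  rw [eLpNorm_one_eq_lintegral_enorm] at this
  calc _ ≤ (eLpNorm f 2 μ * μ Set.univ ^ (1 / (1:ENNReal).toReal - 1 / (2:ENNReal).toReal)) ^ 2 := by
        gcongr
    _ = _ := by
        rw [mul_pow, aux_eL2, mul_comm]
        congr 1
        rw [← ENNReal.rpow_natCast, ← ENNReal.rpow_mul]
        norm_num

lemma aux_meas (w : ℝ → ℝ → ℝ) (hwmeas : Measurable (Function.uncurry w)) :
    StronglyMeasurable (fun q : ℝ × ℝ => FT (fun x => w x q.2) q.1) := by
  unfold FT
  refine StronglyMeasurable.const_mul ?_ _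
  refine StronglyMeasurable.integral_prod_right
    (f := fun q : ℝ × ℝ => fun x => (w x q.2 : ℂ) * Complex.exp (-(Complex.I * q.1 * x))) ?_
  refine Measurable.stronglyMeasurable ?_
  refine Measurable.mul ?_ ?_
  · refine Complex.measurable_ofReal.comp ?_
    exact hwmeas.comp (measurable_snd.prodMk (measurable_snd.comp measurable_fst))
  · refine Continuous.measurable ?_
    fun_prop

lemma aux_inner (a b T t p : ℝ) (ha : 0 ≤ a) (ht : t ∈ Set.Icc 0 T) (g : ℂ) (M : ℝ)
    (hM : p ^ 4 * ‖(Real.sqrt (2 * Real.pi) : ℂ) * g‖ ≤ M) (f : ℝ → ℂ)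
    (hf : AEStronglyMeasurable f (volume.restrict (Set.Icc 0 T))) :
    ‖p ^ 8 * ‖∫ s in (0:ℝ)..t,
            Complex.exp (((t - s : ℝ) : ℂ) * (-(p : ℂ) ^ 4 + Complex.I * b * p + a)) *
              (Real.sqrt (2 * Real.pi) : ℂ) * g * f s‖ ^ 2‖ₑ ≤
      ENNReal.ofReal (Real.exp (2 * a * T) * M ^ 2 * T) *
        ∫⁻ s in Set.Icc 0 T, ‖f s‖ₑ ^ 2 := by
  have hT : 0 ≤ T := ht.1.trans ht.2
  have hp4 : 0 ≤ p ^ 4 := by positivity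
  have hM0 : 0 ≤ M := le_trans (by positivity) hM
  set J := ∫ s in (0:ℝ)..t,
            Complex.exp (((t - s : ℝ) : ℂ) * (-(p : ℂ) ^ 4 + Complex.I * b * p + a)) *
              (Real.sqrt (2 * Real.pi) : ℂ) * g * f s with hJ
  have h1 : ‖p ^ 8 * ‖J‖ ^ 2‖ₑ = (ENNReal.ofReal (p ^ 4) * ‖J‖ₑ) ^ 2 := by
    rw [Real.enorm_eq_ofReal (by positivity), ← ofReal_norm, ← ENNReal.ofReal_mul hp4,
      ← ENNReal.ofReal_pow (by positivity)]
    congr 1; ring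
  have h2 : ‖J‖ₑ ≤ ∫⁻ s in Set.Icc 0 T, ENNReal.ofReal (Real.exp (a * T)) *
      ‖(Real.sqrt (2 * Real.pi) : ℂ) * g‖ₑ * ‖f s‖ₑ := by
    rw [hJ, intervalIntegral.integral_of_le ht.1]
    refine (enorm_integral_le_lintegral_enorm _).trans ?_
    refine (setLIntegral_mono' measurableSet_Ioc ?_).trans
      (lintegral_mono_set (Set.Ioc_subset_Icc_self.trans (Set.Icc_subset_Icc_right ht.2)))
    intro s hs
    rw [mul_assoc _ _ g, enorm_mul, enorm_mul]
    gcongr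
    rw [← ofReal_norm, Complex.norm_exp]
    refine ENNReal.ofReal_le_ofReal (Real.exp_le_exp.2 ?_)
    have : ((((t - s : ℝ) : ℂ)) * (-(p : ℂ) ^ 4 + Complex.I * b * p + a)).re
        = (t - s) * (a - p ^ 4) := by
      rw [Complex.re_ofReal_mul]
      congr 1
      rw [← Complex.ofReal_pow]
      simp [-Complex.ofReal_pow]
      ring
    rw [this]
    have h3 : 0 ≤ t - s := by linarith [hs.2]
    have h4 : t - s ≤ T := by linarith [hs.1, ht.2]
    nlinarith [mul_nonneg h3 hp4, mul_le_mul_of_nonneg_left h4 ha]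
  have h3 : ENNReal.ofReal (p ^ 4) * ‖J‖ₑ ≤
      ENNReal.ofReal (Real.exp (a * T) * M) * ∫⁻ s in Set.Icc 0 T, ‖f s‖ₑ := by
    calc _ ≤ ENNReal.ofReal (p ^ 4) * ∫⁻ s in Set.Icc 0 T, ENNReal.ofReal (Real.exp (a * T)) *
            ‖(Real.sqrt (2 * Real.pi) : ℂ) * g‖ₑ * ‖f s‖ₑ := by gcongr
      _ = ENNReal.ofReal (Real.exp (a * T)) * (ENNReal.ofReal (p ^ 4) *
            ‖(Real.sqrt (2 * Real.pi) : ℂ) * g‖ₑ) * ∫⁻ s in Set.Icc 0 T, ‖f s‖ₑ := by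
          rw [lintegral_const_mul' _ _ (by finiteness)]
          ring
      _ ≤ _ := by
          rw [ENNReal.ofReal_mul (Real.exp_nonneg _)]
          gcongr
          rw [← ofReal_norm, ← ENNReal.ofReal_mul hp4]
          exact ENNReal.ofReal_le_ofReal hM
  rw [h1]
  calc _ ≤ (ENNReal.ofReal (Real.exp (a * T) * M) * ∫⁻ s in Set.Icc 0 T, ‖f s‖ₑ) ^ 2 := by gcongr
    _ = ENNReal.ofReal (Real.exp (2 * a * T) * M ^ 2) * (∫⁻ s in Set.Icc 0 T, ‖f s‖ₑ) ^ 2 := by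
        rw [mul_pow, ← ENNReal.ofReal_pow (by positivity), mul_pow, ← Real.exp_nat_mul]
        congr 4
        push_cast; ring
    _ ≤ ENNReal.ofReal (Real.exp (2 * a * T) * M ^ 2) * (ENNReal.ofReal T *
          ∫⁻ s in Set.Icc 0 T, ‖f s‖ₑ ^ 2) := by
        gcongr
        have := aux_CS _ f hf
        simpa using this
    _ = _ := by
        rw [ENNReal.ofReal_mul (q := T) (by positivity), mul_assoc (ENNReal.ofReal _)]

lemma aux_final (T k H : ℝ) (hT : 0 < T) (hk : 0 < k) (hH : 0 ≤ H) (V W : ℝ → ℝ)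
    (hV0 : ∀ t, 0 ≤ V t) (hW0 : ∀ t, 0 ≤ W t)
    (hV : AEStronglyMeasurable V (volume.restrict (Set.Icc 0 T)))
    (hVf : (∫⁻ t in Set.Icc (0:ℝ) T, ENNReal.ofReal (V t)) < ⊤)
    (hw : ∀ᵐ s ∂(volume.restrict (Set.Icc (0:ℝ) T)), √(W s) ≤ k * √(V s) + H) :
    ∫⁻ s in Set.Icc 0 T, ENNReal.ofReal (W s) ≤
      ENNReal.ofReal ((k * √(∫ t in (0:ℝ)..T, V t) + √T * H) ^ 2) := by
  set μ := volume.restrict (Set.Icc (0:ℝ) T) with hμ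
  have sq : ∀ U : ℝ → ℝ, (∀ t, 0 ≤ U t) →
      ∫⁻ s, ENNReal.ofReal (U s) ∂μ = eLpNorm (fun s => √(U s)) 2 μ ^ 2 := by
    intro U hU
    rw [aux_eL2]
    refine lintegral_congr fun s => ?_
    rw [Real.enorm_eq_ofReal (Real.sqrt_nonneg _), ← ENNReal.ofReal_pow (Real.sqrt_nonneg _),
      Real.sq_sqrt (hU s)]
  have hA : ∫⁻ s, ENNReal.ofReal (V s) ∂μ = ENNReal.ofReal (∫ t in (0:ℝ)..T, V t) := by
    rw [intervalIntegral.integral_of_le hT.le, ← integral_Icc_eq_integral_Ioc, ← hμ,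
      ofReal_integral_eq_lintegral_ofReal _ (Filter.Eventually.of_forall hV0)]
    refine ⟨hV, ?_⟩
    rw [hasFiniteIntegral_iff_ofReal (Filter.Eventually.of_forall hV0)]
    exact hVf
  have hA0 : 0 ≤ ∫ t in (0:ℝ)..T, V t :=
    intervalIntegral.integral_nonneg hT.le fun t _ => hV0 t
  have hVn : eLpNorm (fun s => √(V s)) 2 μ = ENNReal.ofReal √(∫ t in (0:ℝ)..T, V t) := by
    have h2 := (sq V hV0).symm.trans hA
    refine (ENNReal.pow_right_strictMono (n := 2) (by norm_num)).injective ?_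
    rw [h2, ← ENNReal.ofReal_pow (Real.sqrt_nonneg _), Real.sq_sqrt hA0]
  have hsV : AEStronglyMeasurable (fun s => √(V s)) μ :=
    Real.continuous_sqrt.comp_aestronglyMeasurable hV
  rw [sq W hW0, ENNReal.ofReal_pow (by positivity)]
  gcongr
  calc eLpNorm (fun s => √(W s)) 2 μ ≤ eLpNorm ((k • fun s => √(V s)) + fun _ => H) 2 μ := by
        refine eLpNorm_mono_ae ?_
        filter_upwards [hw] with s hs
        simp only [Pi.add_apply, Pi.smul_apply, smul_eq_mul]
        rw [Real.norm_of_nonneg (Real.sqrt_nonneg _), Real.norm_of_nonneg (by positivity)]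
        exact hs
    _ ≤ _ := eLpNorm_add_le (hsV.const_smul k) aestronglyMeasurable_const (by norm_num)
    _ = _ := by
        rw [eLpNorm_const_smul, hVn, eLpNorm_const' _ (by norm_num) (by norm_num),
          ENNReal.ofReal_add (by positivity) (by positivity), ENNReal.ofReal_mul hk.le,
          ENNReal.ofReal_mul (Real.sqrt_nonneg _), Real.enorm_eq_ofReal hk.le,
          Real.enorm_eq_ofReal hH, mul_comm (ENNReal.ofReal H)]
        congr 2
        simp only [hμ, Measure.restrict_apply_univ, Real.volume_Icc, sub_zero]
        rw [Real.sqrt_eq_rpow, ENNReal.ofReal_rpow_of_pos hT]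
        norm_num

theorem stmt8 (a b T k : ℝ) (ha : 0 ≤ a) (hT : 0 < T) (hk : 0 < k)
    (h : ℝ → ℝ) (hh2 : Integrable (fun x => (h x) ^ 2)) (hhpos : ∀ x, 0 ≤ h x)
    (G : ℝ → ℝ) (hGsmooth : ContDiff ℝ 4 G)
    (hGint : ∀ n : ℕ, n ≤ 4 → Integrable (iteratedDeriv n G))
    (hGdecay : ∀ n : ℕ, n ≤ 3 →
      Filter.Tendsto (iteratedDeriv n G) (Filter.cocompact ℝ) (nhds 0))
    (v : ℝ → ℝ → ℝ) (hvmeas : Measurable (Function.uncurry v))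
    (hv2 : ∀ᵐ t ∂(volume.restrict (Set.Icc (0:ℝ) T)),
      Integrable (fun x => (v x t) ^ 2))
    (hvL2 : (∫⁻ t in Set.Icc (0:ℝ) T,
      ENNReal.ofReal (∫ x : ℝ, (v x t) ^ 2)) < ⊤)
    (w : ℝ → ℝ → ℝ) (hwmeas : Measurable (Function.uncurry w))
    (hw : ∀ᵐ s ∂(volume.restrict (Set.Icc (0:ℝ) T)),
      Integrable (fun x => w x s) ∧ Integrable (fun x => (w x s) ^ 2) ∧
        Real.sqrt (∫ x : ℝ, (w x s) ^ 2) ≤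
          k * Real.sqrt (∫ x : ℝ, (v x s) ^ 2) + Real.sqrt (∫ x : ℝ, (h x) ^ 2)) :
    ∫ t in (0:ℝ)..T, ∫ p : ℝ,
        p ^ 8 * ‖∫ s in (0:ℝ)..t,
            Complex.exp (((t - s : ℝ) : ℂ) * (-(p : ℂ) ^ 4 + Complex.I * b * p + a)) *
              (Real.sqrt (2 * Real.pi) : ℂ) * FT G p * FT (fun x => w x s) p‖ ^ 2 ≤
      Real.exp (2 * a * T) * (∫ x : ℝ, |iteratedDeriv 4 G x|) ^ 2 * T ^ 2 *
        (k * Real.sqrt (∫ t in (0:ℝ)..T, ∫ x : ℝ, (v x t) ^ 2) +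
          Real.sqrt T * Real.sqrt (∫ x : ℝ, (h x) ^ 2)) ^ 2 := by
  set M := ∫ x : ℝ, |iteratedDeriv 4 G x| with hMdef
  set B := k * Real.sqrt (∫ t in (0:ℝ)..T, ∫ x : ℝ, (v x t) ^ 2) +
          Real.sqrt T * Real.sqrt (∫ x : ℝ, (h x) ^ 2) with hB
  have hC : 0 ≤ Real.exp (2 * a * T) * M ^ 2 * T := by positivity
  have hmeas := aux_meas w hwmeas
  have hfin : ∫⁻ s in Set.Icc 0 T, ENNReal.ofReal (∫ x, (w x s) ^ 2) ≤ ENNReal.ofReal (B ^ 2) := by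
    refine aux_final T k _ hT hk (Real.sqrt_nonneg _) (fun t => ∫ x, (v x t) ^ 2)
      (fun s => ∫ x, (w x s) ^ 2) (fun t => integral_nonneg fun x => sq_nonneg _)
      (fun t => integral_nonneg fun x => sq_nonneg _) ?_ hvL2 (hw.mono fun s hs => hs.2.2)
    refine StronglyMeasurable.aestronglyMeasurable ?_
    refine StronglyMeasurable.integral_prod_right (f := fun t x => v x t ^ 2) ?_
    exact ((hvmeas.comp measurable_swap).pow_const 2).stronglyMeasurable
  have hL2 : ∫⁻ p, ∫⁻ s in Set.Icc 0 T, ‖FT (fun x => w x s) p‖ₑ ^ 2 ≤ ENNReal.ofReal (B ^ 2) := by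
    rw [lintegral_lintegral_swap (hmeas.measurable.enorm.pow_const 2).aemeasurable]
    refine le_trans (le_of_eq (lintegral_congr_ae ?_)) hfin
    filter_upwards [hw] with s hs
    exact aux_FT_L2 _ hs.1 hs.2.1
  have hR : 0 ≤ Real.exp (2 * a * T) * M ^ 2 * T ^ 2 * B ^ 2 := by positivity
  refine (Real.le_norm_self _).trans ?_
  rw [← ENNReal.ofReal_le_ofReal_iff hR, ofReal_norm, intervalIntegral.integral_of_le hT.le]
  refine (enorm_integral_le_lintegral_enorm _).trans ?_
  have hin : ∀ t ∈ Set.Ioc 0 T, ‖∫ p : ℝ,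
        p ^ 8 * ‖∫ s in (0:ℝ)..t,
            Complex.exp (((t - s : ℝ) : ℂ) * (-(p : ℂ) ^ 4 + Complex.I * b * p + a)) *
              (Real.sqrt (2 * Real.pi) : ℂ) * FT G p * FT (fun x => w x s) p‖ ^ 2‖ₑ ≤
      ENNReal.ofReal (Real.exp (2 * a * T) * M ^ 2 * T) * ENNReal.ofReal (B ^ 2) := by
    intro t ht
    refine (enorm_integral_le_lintegral_enorm _).trans ?_
    refine (lintegral_mono fun p => aux_inner a b T t p ha (Set.Ioc_subset_Icc_self ht) (FT G p) M
      (aux_G G hGsmooth hGint p) (fun s => FT (fun x => w x s) p)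
      (hmeas.comp_measurable measurable_prodMk_left).aestronglyMeasurable).trans ?_
    rw [lintegral_const_mul' _ _ ENNReal.ofReal_ne_top]
    gcongr
  refine (setLIntegral_mono' measurableSet_Ioc hin).trans (le_of_eq ?_)
  rw [setLIntegral_const, Real.volume_Ioc, sub_zero, ← ENNReal.ofReal_mul hC,
    ← ENNReal.ofReal_mul (by positivity)]
  congr 1
  ring
end

section
/- Let a ≥ 0, b ∈ ℝ, T > 0, G ∈ L¹(ℝ), and let F : ℝ × ℝ → ℝ be measurable with |F(u₁,x) − F(u₂,x)| ≤ l|u₁ − u₂| for all u₁, u₂, x, where l > 0. Let v₁, v₂ : ℝ × [0,T] → ℝ be measurable with vⱼ(·,t) ∈ L²(ℝ) for a.e. t, ∫₀ᵀ ‖vⱼ(·,t)‖²_{L²(ℝ)} dt < ∞, and x ↦ F(vⱼ(x,s),x) in L¹(ℝ) ∩ L²(ℝ) for a.e. s (j = 1,2); write f̂_{vⱼ}(p,s) for the Fourier transform of x ↦ F(vⱼ(x,s),x), and set W(p,t) := ∫₀ᵗ e^{(t−s)(−p⁴+ibp+a)} √(2π) Ĝ(p) ( f̂_{v₁}(p,s)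 − f̂_{v₂}(p,s) ) ds. Then for every t ∈ [0,T], (∫_ℝ |W(p,t)|² dp)^{1/2} ≤ e^{aT} l √T ‖G‖_{L¹(ℝ)} ‖v₁ − v₂‖_{L²(ℝ×[0,T])}. -/
open MeasureTheory

open scoped FourierTransform SchwartzMap ContDiff ENNReal

theorem planch_ae (f : ℝ → ℂ) (h1 : Integrable f) (h2 : MemLp f 2) :
    ∀ᵐ x, 𝓕 f x = (𝓕 (h2.toLp f) : Lp (α := ℝ) ℂ 2) x := by
  have hc : Continuous (𝓕 f) := 
    VectorFourier.fourierIntegral_continuous Real.continuous_fourierChar (by fun_prop) h1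
  apply ae_eq_of_integral_contDiff_smul_eq hc.locallyIntegrable
    ((Lp.memLp _).locallyIntegrable (by norm_num))
  intro g g_smooth g_cpt
  have hg₁ : HasCompactSupport (Complex.ofRealCLM ∘ g) := g_cpt.comp_left rfl
  have hg₂ : ContDiff ℝ ∞ (Complex.ofRealCLM ∘ g) := by fun_prop
  set G : 𝓢(ℝ, ℂ) := hg₁.toSchwartzMap hg₂ with hG
  have hGx : ∀ x, G x = (g x : ℂ) := fun x => by simp [hG]
  have key := congrArg (fun D => D G) (Lp.fourier_toTemperedDistribution_eq (h2.toLp f))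
  simp only [TemperedDistribution.fourier_apply, Lp.toTemperedDistribution_apply] at key
  have e1 : ∫ x, (𝓕 G) x • (h2.toLp f) x = ∫ x, (𝓕 G) x • f x := by
    apply integral_congr_ae
    filter_upwards [h2.coeFn_toLp] with x hx
    rw [hx]
  have e2 : ∫ x, (𝓕 G) x • f x = ∫ x, G x • 𝓕 f x := by
    have := VectorFourier.integral_fourierIntegral_smul_eq_flip (μ := volume) (ν := volume)
      (L := innerₗ ℝ) (f := G) (g := f) Real.continuous_fourierChar (by fun_prop)
      G.integrable h1
    rw [flip_innerₗ] at this
    exact this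
  rw [e1, e2] at key
  simpa [hGx] using key

theorem planch1 (f : ℝ → ℂ) (h1 : Integrable f) (h2 : MemLp f 2) :
    ∫⁻ x, ‖𝓕 f x‖ₑ ^ 2 = ∫⁻ x, ‖f x‖ₑ ^ 2 := by
  have h := planch_ae f h1 h2
  have a1 : eLpNorm (𝓕 f) 2 = eLpNorm f 2 := by
    rw [eLpNorm_congr_ae h, ← eLpNorm_congr_ae h2.coeFn_toLp, ← Lp.enorm_def, ← Lp.enorm_def,
      ← ofReal_norm, ← ofReal_norm, Lp.norm_fourier_eq]
  have := congrArg (fun z => z ^ 2) a1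
  have k : ∀ u : ℝ → ℂ, eLpNorm u 2 ^ 2 = ∫⁻ x, ‖u x‖ₑ ^ 2 := by
    intro u
    have := eLpNorm_nnreal_pow_eq_lintegral (μ := volume) (f := u) (p := 2) (by norm_num)
    simpa using this
  simpa [k] using this

theorem FT_eq (φ : ℝ → ℝ) (p : ℝ) :
    FT φ p = (Real.sqrt (2 * Real.pi))⁻¹ * 𝓕 (fun x => (φ x : ℂ)) ((2 * Real.pi)⁻¹ * p) := by
  unfold FT
  congr 1
  rw [Real.fourier_real_eq_integral_exp_smul]
  congr 1
  ext x
  rw [smul_eq_mul, mul_comm]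
  congr 2
  have : (Real.pi : ℂ) ≠ 0 := by exact_mod_cast Real.pi_ne_zero
  push_cast
  field_simp

theorem planch2 (φ : ℝ → ℝ) (h1 : Integrable φ) (h2 : Integrable (fun x => φ x ^ 2)) :
    ∫⁻ p, ‖FT φ p‖ₑ ^ 2 = ∫⁻ x, ENNReal.ofReal (φ x ^ 2) := by
  have i1 : Integrable (fun x => (φ x : ℂ)) := h1.ofReal
  have i2 : MemLp (fun x => (φ x : ℂ)) 2 := by
    have : MemLp φ 2 := (memLp_two_iff_integrable_sq h1.1).2 h2
    exact this.ofReal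
  have hp := planch1 _ i1 i2
  have hpos : 0 < 2 * Real.pi := by positivity
  have hc : Continuous (𝓕 (fun x => (φ x : ℂ))) := 
    VectorFourier.fourierIntegral_continuous Real.continuous_fourierChar (by fun_prop) i1
  have e1 : ∀ p, ‖FT φ p‖ₑ ^ 2 = ENNReal.ofReal (2 * Real.pi)⁻¹ *
      ‖𝓕 (fun x => (φ x : ℂ)) ((2 * Real.pi)⁻¹ * p)‖ₑ ^ 2 := by
    intro p
    rw [FT_eq, enorm_mul, mul_pow]
    congr 1
    rw [← ofReal_norm, ← ENNReal.ofReal_pow (norm_nonneg _)]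
    congr 1
    rw [Complex.norm_real, norm_inv, Real.norm_of_nonneg (Real.sqrt_nonneg _), inv_pow, Real.sq_sqrt hpos.le]
  simp_rw [e1]
  generalize 𝓕 (fun x => (φ x : ℂ)) = K at *
  have hK : Measurable K := hc.measurable
  rw [lintegral_const_mul _ (by fun_prop)]
  have e2 := Real.smul_map_volume_mul_left (a := (2 * Real.pi)⁻¹) (by positivity)
  have e3 : ∫⁻ p, ‖K p‖ₑ ^ 2 = ENNReal.ofReal (2 * Real.pi)⁻¹ *
      ∫⁻ p, ‖K ((2 * Real.pi)⁻¹ * p)‖ₑ ^ 2 := by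
    conv_lhs => rw [← e2]
    rw [lintegral_smul_measure, lintegral_map (by fun_prop) (by fun_prop),
      abs_of_pos (by positivity), smul_eq_mul]
  rw [hp] at e3
  rw [← e3]
  apply lintegral_congr
  intro x
  rw [← ofReal_norm, ← ENNReal.ofReal_pow (norm_nonneg _)]
  simp

theorem FT_meas (h : ℝ → ℝ → ℝ) (hm : Measurable (Function.uncurry h)) :
    Measurable (fun z : ℝ × ℝ => FT (fun x => h x z.2) z.1) := by
  unfold FT
  apply Measurable.const_mul
  apply StronglyMeasurable.measurable
  apply StronglyMeasurable.integral_prod_right (f := fun (z : ℝ × ℝ) (x : ℝ) => (h x z.2 : ℂ) * Complex.exp (-(Complex.I * z.1 * x)))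
  apply Measurable.stronglyMeasurable
  have : Measurable (fun q : (ℝ × ℝ) × ℝ => h q.2 q.1.2) :=
    hm.comp (f := fun q : (ℝ × ℝ) × ℝ => (q.2, q.1.2)) (by fun_prop)
  simp only [Function.uncurry_def]
  fun_prop

theorem FT_bound (G : ℝ → ℝ) (p : ℝ) :
    ‖(Real.sqrt (2 * Real.pi) : ℂ) * FT G p‖ ≤ ∫ x, |G x| := by
  unfold FT
  have : (Real.sqrt (2 * Real.pi) : ℂ) ≠ 0 := by
    exact_mod_cast (Real.sqrt_pos.2 (by positivity)).ne'
  push_cast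
  rw [← mul_assoc, mul_inv_cancel₀ this, one_mul]
  refine (norm_integral_le_integral_norm _).trans (le_of_eq ?_)
  congr 1
  ext x
  have : (-(Complex.I * p * x)) = ((-(p * x) : ℝ) : ℂ) * Complex.I := by push_cast; ring
  rw [norm_mul, this, Complex.norm_exp_ofReal_mul_I]
  simp

theorem FT_sub (f g : ℝ → ℝ) (hf : Integrable f) (hg : Integrable g) (p : ℝ) :
    FT f p - FT g p = FT (fun x => f x - g x) p := by
  unfold FT
  have k : ∀ f : ℝ → ℝ, Integrable f → Integrable (fun x => (f x : ℂ) * Complex.exp (-(Complex.I * p * x))) := by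
    intro f hf
    refine (hf.ofReal (𝕜 := ℂ)).mul_bdd (c := 1) (by fun_prop) (ae_of_all _ fun x => ?_)
    have : (-(Complex.I * p * x)) = ((-(p * x) : ℝ) : ℂ) * Complex.I := by push_cast; ring
    rw [this, Complex.norm_exp_ofReal_mul_I]
  rw [← mul_sub, ← integral_sub (k f hf) (k g hg)]
  congr 2
  ext x
  push_cast
  ring

theorem cs_sq (μ : Measure ℝ) (f : ℝ → ℝ≥0∞) (hf : Measurable f) :
    (∫⁻ s, f s ∂μ) ^ 2 ≤ μ Set.univ * ∫⁻ s, f s ^ 2 ∂μ := by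
  have h := ENNReal.lintegral_mul_le_Lp_mul_Lq μ Real.HolderConjugate.two_two
    (f := fun _ => 1) (g := f) aemeasurable_const hf.aemeasurable
  have h2 := pow_le_pow_left' h 2
  simp only [Pi.mul_apply, one_mul, mul_pow, ← ENNReal.rpow_natCast, ← ENNReal.rpow_mul] at h2
  simpa using h2

theorem stmt11 (a b T l : ℝ) (ha : 0 ≤ a) (hT : 0 < T) (hl : 0 < l)
    (G : ℝ → ℝ) (hG : Integrable G)
    (F : ℝ → ℝ → ℝ) (hFmeas : Measurable (Function.uncurry F))
    (hlip : ∀ u₁ u₂ x : ℝ, |F u₁ x - F u₂ x| ≤ l * |u₁ - u₂|)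
    (v₁ v₂ : ℝ → ℝ → ℝ)
    (hv₁meas : Measurable (Function.uncurry v₁))
    (hv₂meas : Measurable (Function.uncurry v₂))
    (hv₁2 : ∀ᵐ t ∂(volume.restrict (Set.Icc (0:ℝ) T)),
      Integrable (fun x => (v₁ x t) ^ 2))
    (hv₂2 : ∀ᵐ t ∂(volume.restrict (Set.Icc (0:ℝ) T)),
      Integrable (fun x => (v₂ x t) ^ 2))
    (hv₁L2 : (∫⁻ t in Set.Icc (0:ℝ) T,
      ENNReal.ofReal (∫ x : ℝ, (v₁ x t) ^ 2)) < ⊤)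
    (hv₂L2 : (∫⁻ t in Set.Icc (0:ℝ) T,
      ENNReal.ofReal (∫ x : ℝ, (v₂ x t) ^ 2)) < ⊤)
    (hFv₁ : ∀ᵐ s ∂(volume.restrict (Set.Icc (0:ℝ) T)),
      Integrable (fun x => F (v₁ x s) x) ∧ Integrable (fun x => (F (v₁ x s) x) ^ 2))
    (hFv₂ : ∀ᵐ s ∂(volume.restrict (Set.Icc (0:ℝ) T)),
      Integrable (fun x => F (v₂ x s) x) ∧ Integrable (fun x => (F (v₂ x s) x) ^ 2))
    (W : ℝ → ℝ → ℂ)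
    (hW : ∀ p t : ℝ, W p t = ∫ s in (0:ℝ)..t,
      Complex.exp (((t - s : ℝ) : ℂ) * (-(p : ℂ) ^ 4 + Complex.I * b * p + a)) *
        (Real.sqrt (2 * Real.pi) : ℂ) *
        FT G p * (FT (fun x => F (v₁ x s) x) p - FT (fun x => F (v₂ x s) x) p)) :
    ∀ t ∈ Set.Icc (0:ℝ) T,
      Real.sqrt (∫ p : ℝ, ‖W p t‖ ^ 2) ≤
        Real.exp (a * T) * l * Real.sqrt T * (∫ x : ℝ, |G x|) *
          Real.sqrt (∫ t' in (0:ℝ)..T, ∫ x : ℝ, (v₁ x t' - v₂ x t') ^ 2) := by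
  intro t ht
  set μ := volume.restrict (Set.Icc (0:ℝ) T) with hμ
  have hh : ∀ v : ℝ → ℝ → ℝ, Measurable (Function.uncurry v) →
      Measurable (Function.uncurry (fun x s => F (v x s) x)) := by
    intro v hv
    exact hFmeas.comp (f := fun q : ℝ × ℝ => (Function.uncurry v q, q.1)) (by fun_prop)
  set g : ℝ → ℝ → ℂ := fun p s => FT (fun x => F (v₁ x s) x) p - FT (fun x => F (v₂ x s) x) p
    with hg
  have hgm : Measurable (Function.uncurry g) := (FT_meas _ (hh v₁ hv₁meas)).sub (FT_meas _ (hh v₂ hv₂meas))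
  have hgm1 : ∀ p, Measurable (g p) := fun p => hgm.comp (f := fun s => (p, s)) (by fun_prop)
  set N := ∫ x, |G x| with hN
  have hN0 : 0 ≤ N := integral_nonneg fun x => abs_nonneg _
  set C := Real.exp (a * T) * N with hC
  have hC0 : 0 ≤ C := by positivity
  have A : ∀ p, ‖W p t‖ₑ ≤ ENNReal.ofReal C * ∫⁻ s, ‖g p s‖ₑ ∂μ := by
    intro p
    rw [hW, intervalIntegral.integral_of_le ht.1]
    refine (enorm_integral_le_lintegral_enorm _).trans ?_
    rw [← lintegral_const_mul _ (hgm1 p).enorm]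
    refine le_trans (setLIntegral_mono' measurableSet_Ioc (g := fun s => ENNReal.ofReal C * ‖g p s‖ₑ) ?_)
      (lintegral_mono_set fun s hs => ⟨hs.1.le, hs.2.trans ht.2⟩)
    intro s hs
    rw [enorm_mul]
    gcongr
    rw [← ofReal_norm]
    apply ENNReal.ofReal_le_ofReal
    rw [mul_assoc, norm_mul, hC]
    refine mul_le_mul ?_ (FT_bound G p) (norm_nonneg _) (Real.exp_pos _).le
    rw [Complex.norm_exp]
    apply Real.exp_le_exp.2
    have : ((((t - s : ℝ) : ℂ) * (-(p : ℂ) ^ 4 + Complex.I * b * p + a))).re = (t - s) * (-p ^ 4 + a) := by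
      rw [Complex.re_ofReal_mul]
      congr 1
      have : (-(p : ℂ) ^ 4 + Complex.I * b * p + a) = ((-p ^ 4 + a : ℝ) : ℂ) + ((b * p : ℝ) : ℂ) * Complex.I := by
        push_cast; ring
      rw [this, Complex.add_re, Complex.ofReal_re, Complex.re_ofReal_mul]
      simp
    rw [this]
    have h1 : 0 ≤ t - s := sub_nonneg.2 hs.2
    have h2 : t - s ≤ T := by linarith [ht.2, hs.1]
    have h3 : 0 ≤ p ^ 4 := by positivity
    nlinarith [mul_nonneg h1 h3, mul_le_mul_of_nonneg_left h2 ha]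
  have B : ∀ p, ‖W p t‖ₑ ^ 2 ≤ ENNReal.ofReal (C ^ 2 * T) * ∫⁻ s, ‖g p s‖ₑ ^ 2 ∂μ := by
    intro p
    refine (pow_le_pow_left' (A p) 2).trans ?_
    rw [mul_pow, ENNReal.ofReal_mul (p := C ^ 2) (by positivity), ENNReal.ofReal_pow hC0, mul_assoc]
    gcongr
    refine (cs_sq μ _ (hgm1 p).enorm).trans (le_of_eq ?_)
    simp [hμ]
  have hvm : Measurable (fun q : ℝ × ℝ => (v₁ q.2 q.1 - v₂ q.2 q.1) ^ 2) := by
    have e1 : Measurable (fun q : ℝ × ℝ => v₁ q.2 q.1) :=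
      hv₁meas.comp (f := fun q : ℝ × ℝ => (q.2, q.1)) (by fun_prop)
    have e2 : Measurable (fun q : ℝ × ℝ => v₂ q.2 q.1) :=
      hv₂meas.comp (f := fun q : ℝ × ℝ => (q.2, q.1)) (by fun_prop)
    fun_prop
  have hvm1 : ∀ s, Measurable (fun x => (v₁ x s - v₂ x s) ^ 2) :=
    fun s => hvm.comp (f := fun x => (s, x)) (by fun_prop)
  set D : ℝ → ℝ := fun s => ∫ x, (v₁ x s - v₂ x s) ^ 2 with hD
  have hDm : StronglyMeasurable D := by
    apply StronglyMeasurable.integral_prod_right (f := fun s x => (v₁ x s - v₂ x s) ^ 2)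
    exact hvm.stronglyMeasurable
  have hD0 : ∀ s, 0 ≤ D s := fun s => integral_nonneg fun x => sq_nonneg _
  have hle : ∀ x s, (v₁ x s - v₂ x s) ^ 2 ≤ 2 * (v₁ x s) ^ 2 + 2 * (v₂ x s) ^ 2 := by
    intro x s; nlinarith [sq_nonneg (v₁ x s + v₂ x s)]
  have hDint : ∀ᵐ s ∂μ, Integrable (fun x => (v₁ x s - v₂ x s) ^ 2) := by
    filter_upwards [hv₁2, hv₂2] with s h1 h2
    refine Integrable.mono' ((h1.const_mul 2).add (h2.const_mul 2)) (hvm1 s).aestronglyMeasurable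
      (ae_of_all _ fun x => ?_)
    rw [Real.norm_of_nonneg (sq_nonneg _)]
    exact hle x s
  have hDfin : ∫⁻ s, ENNReal.ofReal (D s) ∂μ < ⊤ := by
    have hb : ∫⁻ s, ENNReal.ofReal (D s) ∂μ ≤ ∫⁻ s, (2 * ENNReal.ofReal (∫ x : ℝ, (v₁ x s) ^ 2) +
        2 * ENNReal.ofReal (∫ x : ℝ, (v₂ x s) ^ 2)) ∂μ := by
      apply lintegral_mono_ae
      filter_upwards [hv₁2, hv₂2, hDint] with s h1 h2 h3
      have e : D s ≤ 2 * (∫ x : ℝ, (v₁ x s) ^ 2) + 2 * (∫ x : ℝ, (v₂ x s) ^ 2) := by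
        rw [← integral_const_mul, ← integral_const_mul, ← integral_add (h1.const_mul 2) (h2.const_mul 2)]
        exact integral_mono h3 ((h1.const_mul 2).add (h2.const_mul 2)) fun x => hle x s
      refine (ENNReal.ofReal_le_ofReal e).trans ?_
      refine ENNReal.ofReal_add_le.trans (le_of_eq ?_)
      rw [ENNReal.ofReal_mul (by norm_num), ENNReal.ofReal_mul (by norm_num)]
      simp
    refine hb.trans_lt ?_
    have m1 : Measurable (fun s => ENNReal.ofReal (∫ x : ℝ, (v₁ x s) ^ 2)) := by
      apply Measurable.ennreal_ofReal
      apply StronglyMeasurable.measurable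
      apply StronglyMeasurable.integral_prod_right (f := fun s x => (v₁ x s) ^ 2)
      exact ((hv₁meas.comp (f := fun q : ℝ × ℝ => (q.2, q.1)) (by fun_prop)).pow_const 2).stronglyMeasurable
    rw [lintegral_add_left (m1.const_mul 2), lintegral_const_mul' _ _ (by norm_num), lintegral_const_mul' _ _ (by norm_num)]
    exact ENNReal.add_lt_top.2 ⟨ENNReal.mul_lt_top (by norm_num) hv₁L2,
      ENNReal.mul_lt_top (by norm_num) hv₂L2⟩
  have hDI : Integrable D μ := by
    refine ⟨hDm.aestronglyMeasurable, ?_⟩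
    rw [hasFiniteIntegral_iff_ofReal (ae_of_all _ hD0)]
    exact hDfin
  have hDeq : ∫ s in (0:ℝ)..T, D s = ∫ s, D s ∂μ := by
    rw [intervalIntegral.integral_of_le hT.le, hμ, integral_Icc_eq_integral_Ioc]
  have hP : ∀ᵐ s ∂μ, ∫⁻ p, ‖g p s‖ₑ ^ 2 ≤ ENNReal.ofReal (l ^ 2) * ENNReal.ofReal (D s) := by
    filter_upwards [hFv₁, hFv₂, hDint] with s h1 h2 h3
    have e : ∀ p, g p s = FT (fun x => F (v₁ x s) x - F (v₂ x s) x) p :=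
      fun p => FT_sub _ _ h1.1 h2.1 p
    have hpt : ∀ x, (F (v₁ x s) x - F (v₂ x s) x) ^ 2 ≤ l ^ 2 * (v₁ x s - v₂ x s) ^ 2 := by
      intro x
      rw [← sq_abs, ← sq_abs (v₁ x s - v₂ x s), ← mul_pow]
      exact pow_le_pow_left₀ (abs_nonneg _) (hlip _ _ _) 2
    have hsq : Integrable (fun x => (F (v₁ x s) x - F (v₂ x s) x) ^ 2) := by
      refine Integrable.mono' (h3.const_mul (l ^ 2)) ((h1.1.1.sub h2.1.1).pow 2)
        (ae_of_all _ fun x => ?_)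
      rw [Real.norm_of_nonneg (sq_nonneg _)]
      exact hpt x
    simp_rw [e]
    rw [planch2 (fun x => F (v₁ x s) x - F (v₂ x s) x) (h1.1.sub h2.1) hsq, ← ENNReal.ofReal_mul (by positivity), hD]
    simp only
    rw [← integral_const_mul, ofReal_integral_eq_lintegral_ofReal (h3.const_mul (l ^ 2))
      (ae_of_all _ fun x => by positivity)]
    exact lintegral_mono fun x => ENNReal.ofReal_le_ofReal (hpt x)
  have main : ENNReal.ofReal (∫ p, ‖W p t‖ ^ 2) ≤ ENNReal.ofReal (C ^ 2 * T * (l ^ 2 * ∫ s, D s ∂μ)) := by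
    have hnn : 0 ≤ ∫ p, ‖W p t‖ ^ 2 := integral_nonneg fun p => sq_nonneg _
    calc ENNReal.ofReal (∫ p, ‖W p t‖ ^ 2) = ‖∫ p, ‖W p t‖ ^ 2‖ₑ := by
          rw [Real.enorm_of_nonneg hnn]
      _ ≤ ∫⁻ p, ‖‖W p t‖ ^ 2‖ₑ := enorm_integral_le_lintegral_enorm _
      _ = ∫⁻ p, ‖W p t‖ₑ ^ 2 := by simp
      _ ≤ ∫⁻ p, ENNReal.ofReal (C ^ 2 * T) * ∫⁻ s, ‖g p s‖ₑ ^ 2 ∂μ := lintegral_mono B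
      _ = ENNReal.ofReal (C ^ 2 * T) * ∫⁻ p, ∫⁻ s, ‖g p s‖ₑ ^ 2 ∂μ :=
          lintegral_const_mul' _ _ ENNReal.ofReal_ne_top
      _ = ENNReal.ofReal (C ^ 2 * T) * ∫⁻ s, (∫⁻ p, ‖g p s‖ₑ ^ 2) ∂μ := by
          rw [lintegral_lintegral_swap]
          exact (hgm.enorm.pow_const 2).aemeasurable
      _ ≤ ENNReal.ofReal (C ^ 2 * T) * ∫⁻ s, ENNReal.ofReal (l ^ 2) * ENNReal.ofReal (D s) ∂μ := by
          exact mul_le_mul_right (lintegral_mono_ae hP) _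
      _ = ENNReal.ofReal (C ^ 2 * T * (l ^ 2 * ∫ s, D s ∂μ)) := by
          rw [lintegral_const_mul' _ _ ENNReal.ofReal_ne_top,
            ← ofReal_integral_eq_lintegral_ofReal hDI (ae_of_all _ hD0),
            ENNReal.ofReal_mul (p := C ^ 2 * T) (by positivity), ENNReal.ofReal_mul (p := l ^ 2) (by positivity)]
  rw [hDeq]
  have hI0 : 0 ≤ ∫ s, D s ∂μ := integral_nonneg hD0
  have main' := (ENNReal.ofReal_le_ofReal_iff (by positivity)).1 main
  apply Real.sqrt_le_iff.2
  refine ⟨by positivity, main'.trans (le_of_eq ?_)⟩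
  simp only [mul_pow, Real.sq_sqrt hI0, Real.sq_sqrt hT.le, hC]
  ring
end
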